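/- Let c ∈ ℂ and let y be an entire function, not identically zero, satisfying y''(z) = z·y(z) + c for all z ∈ ℂ. Then y has infinitely many zeros: the set {z ∈ ℂ : y(z) = 0} is infinite. -/

import Mathlib

open Polynomial Metric

lemma airy_factor_one (f : ℂ → ℂ) (hf : Differentiable ℂ f) (hne : f ≠ 0) (a : ℂ) :
    ∃ (n : ℕ) (h : ℂ → ℂ), Differentiable ℂ h ∧ h a ≠ 0 ∧ ∀ z, f z = (z - a) ^ n * h z := by
  have hA : AnalyticOnNhd ℂ f Set.univ := fun z _ => hf.analyticAt z
  have htop : analyticOrderAt f a ≠ ⊤ := by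
    intro h
    rw [analyticOrderAt_eq_top] at h
    apply hne
    funext z
    exact hA.eqOn_zero_of_preconnected_of_eventuallyEq_zero isPreconnected_univ
      (Set.mem_univ a) h (Set.mem_univ z)
  obtain ⟨n, hn⟩ := ENat.ne_top_iff_exists.mp htop
  obtain ⟨g, hg, hga, hfg⟩ := ((hf.analyticAt a).analyticOrderAt_eq_natCast).mp hn.symm
  classical
  have hfa : f a = (a - a) ^ n * g a := by simpa using hfg.self_of_nhds
  refine ⟨n, fun z => if z = a then g a else f z / (z - a) ^ n, ?_, by simpa using hga, ?_⟩
  · intro z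
    by_cases hz : z = a
    · subst hz
      refine hg.differentiableAt.congr_of_eventuallyEq ?_
      filter_upwards [hfg] with w hw
      by_cases hwz : w = z
      · simp [hwz]
      · have : (w - z) ^ n ≠ 0 := pow_ne_zero _ (sub_ne_zero.mpr hwz)
        simp only [hwz, if_false, hw, smul_eq_mul]
        field_simp
    · have h0 : (z - a) ^ n ≠ 0 := pow_ne_zero _ (sub_ne_zero.mpr hz)
      have : DifferentiableAt ℂ (fun z => f z / (z - a) ^ n) z :=
        (hf z).div (by fun_prop) h0
      refine this.congr_of_eventuallyEq ?_
      filter_upwards [isOpen_ne.mem_nhds hz] with w hw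
      have hw' : w ≠ a := hw
      simp [hw']
  · intro z
    by_cases hz : z = a
    · subst hz
      simpa using hfa
    · have h0 : (z - a) ^ n ≠ 0 := pow_ne_zero _ (sub_ne_zero.mpr hz)
      simp only [hz, if_false]
      field_simp

lemma airy_factor (f : ℂ → ℂ) (hf : Differentiable ℂ f) (hne : f ≠ 0) (S : Finset ℂ) :
    ∃ (P : ℂ[X]) (h : ℂ → ℂ) (R : ℝ), P ≠ 0 ∧ Differentiable ℂ h ∧ (∀ a ∈ S, h a ≠ 0) ∧
      (∀ z, f z = P.eval z * h z) ∧ ∀ z : ℂ, R ≤ ‖z‖ → 1 ≤ ‖P.eval z‖ := by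
  classical
  induction S using Finset.induction_on with
  | empty => exact ⟨1, f, 0, one_ne_zero, hf, by simp, by simp, by simp⟩
  | insert a S ha ih =>
    obtain ⟨P, h, R, hP, hh, hS, hfac, hR⟩ := ih
    have hhne : h ≠ 0 := by
      rintro rfl
      exact hne (by funext z; simp [hfac z])
    obtain ⟨n, k, hk, hka, hhk⟩ := airy_factor_one h hh hhne a
    refine ⟨P * (X - C a) ^ n, k, max R (‖a‖ + 1),
      mul_ne_zero hP (pow_ne_zero _ (X_sub_C_ne_zero a)), hk, ?_, ?_, ?_⟩
    · intro b hb
      rcases Finset.mem_insert.mp hb with rfl | hb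
      · exact hka
      · intro h0
        exact hS b hb (by rw [hhk b, h0, mul_zero])
    · intro z
      rw [hfac z, hhk z]
      simp [mul_assoc]
    · intro z hz
      have h1 := hR z ((le_max_left _ _).trans hz)
      have h2 : 1 ≤ ‖z - a‖ := by
        have := norm_sub_norm_le z a
        have := (le_max_right R (‖a‖ + 1)).trans hz
        linarith
      simp only [eval_mul, eval_pow, eval_sub, eval_X, eval_C, norm_mul, norm_pow]
      exact one_le_mul_of_one_le_of_one_le h1 (one_le_pow₀ h2)

lemma airy_log (h : ℂ → ℂ) (hh : Differentiable ℂ h) (h0 : ∀ z, h z ≠ 0) :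
    ∃ g : ℂ → ℂ, Differentiable ℂ g ∧ ∀ z, h z = Complex.exp (g z) := by
  have hd : Differentiable ℂ (deriv h) := by
    intro z
    exact ((hh.analyticAt z).deriv).differentiableAt
  have hq : Differentiable ℂ (fun z => deriv h z / h z) := fun z => (hd z).div (hh z) (h0 z)
  obtain ⟨g, hg0, hg⟩ := (hq.isExactOn_univ).with_val_at 0 (Complex.log (h 0))
  have hg : ∀ z, HasDerivAt g (deriv h z / h z) z := fun z => hg z (Set.mem_univ z)
  refine ⟨g, fun z => (hg z).differentiableAt, fun z => ?_⟩
  have hder : ∀ w, HasDerivAt (fun z => h z * Complex.exp (-g z)) 0 w := by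
    intro w
    have := (hh w).hasDerivAt.mul ((hg w).neg.cexp)
    refine this.congr_deriv ?_
    have := h0 w
    field_simp
    simp
  have hc := is_const_of_deriv_eq_zero (fun w => (hder w).differentiableAt)
    (fun w => (hder w).deriv) z 0
  simp only [hg0] at hc
  rw [Complex.exp_neg, Complex.exp_neg, Complex.exp_log (h0 0), mul_inv_cancel₀ (h0 0)] at hc
  have := Complex.exp_ne_zero (g z)
  field_simp at hc
  exact hc

lemma airy_growth (c : ℂ) (y : ℂ → ℂ) (hy : Differentiable ℂ y)
    (hode : ∀ z : ℂ, deriv (deriv y) z = z * y z + c) :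
    ∃ A : ℝ, 0 ≤ A ∧ ∀ z, ‖y z‖ ≤ A * Real.exp ((1 + ‖z‖) ^ 2) := by
  have hd : Differentiable ℂ (deriv y) := by
    intro z
    exact ((hy.analyticAt z).deriv).differentiableAt
  set δ : ℝ := ‖((y 0, deriv y 0) : ℂ × ℂ)‖ with hδ
  have hδ0 : 0 ≤ δ := norm_nonneg _
  refine ⟨δ + ‖c‖, by positivity, fun z => ?_⟩
  set K : ℝ := (1 + ‖z‖) ^ 2 with hK
  have hr := norm_nonneg z
  have hKpos : 0 < K := by positivity
  let F : ℝ → ℂ × ℂ := fun t => (y (t * z), deriv y (t * z))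
  let F' : ℝ → ℂ × ℂ := fun t => (deriv y (t * z) * z, (t * z * y (t * z) + c) * z)
  have hF : ∀ t, HasDerivAt F (F' t) t := by
    intro t
    have hl : HasDerivAt (fun t : ℝ => (t : ℂ) * z) z t := by
      simpa using (Complex.ofRealCLM.hasDerivAt (x := t)).mul_const z
    have h1 := ((hy (t * z)).hasDerivAt).comp t hl
    have h2 := ((hd (t * z)).hasDerivAt).comp t hl
    rw [hode] at h2
    exact h1.prodMk h2
  have hb := norm_le_gronwallBound_of_norm_deriv_right_le (f := F) (f' := F') (δ := δ) (K := K)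
    (ε := K * ‖c‖) (a := 0) (b := 1) (fun t _ => (hF t).continuousAt.continuousWithinAt)
    (fun t _ => (hF t).hasDerivWithinAt) (by simp [F, hδ]) ?_ 1 (by simp)
  · rw [gronwallBound_of_K_ne_0 hKpos.ne'] at hb
    have h1 : ‖y z‖ ≤ ‖F 1‖ := by
      simpa [F] using norm_fst_le (F 1)
    have h2 : K * ‖c‖ / K = ‖c‖ := by field_simp
    simp only [sub_zero, mul_one, h2] at hb
    have := norm_nonneg c
    nlinarith [Real.exp_pos K]
  · intro t ht
    have e1 : ‖deriv y (t * z)‖ ≤ ‖F t‖ := norm_snd_le (F t)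
    have e2 : ‖y (t * z)‖ ≤ ‖F t‖ := norm_fst_le (F t)
    have hN := norm_nonneg (F t)
    have hc := norm_nonneg c
    have hcK : ‖z‖ * ‖c‖ ≤ K * ‖c‖ := by
      apply mul_le_mul_of_nonneg_right _ hc
      nlinarith
    have hcK0 : 0 ≤ K * ‖c‖ := by positivity
    rw [Prod.norm_def]
    apply max_le
    · simp only [F', norm_mul]
      have : ‖deriv y (t * z)‖ * ‖z‖ ≤ ‖F t‖ * K :=
        mul_le_mul e1 (by nlinarith) hr hN
      linarith
    · simp only [F', norm_mul]
      have h3 : ‖(t * z * y (t * z) + c : ℂ)‖ ≤ ‖z‖ * ‖F t‖ + ‖c‖ := by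
        refine (norm_add_le _ _).trans ?_
        gcongr
        rw [norm_mul, norm_mul]
        refine mul_le_mul ?_ e2 (norm_nonneg _) hr
        rw [Complex.norm_real, Real.norm_of_nonneg ht.1]
        nlinarith [ht.2]
      have h4 : ‖(t * z * y (t * z) + c : ℂ)‖ * ‖z‖ ≤ (‖z‖ * ‖F t‖ + ‖c‖) * ‖z‖ := by gcongr
      have h5 : ‖z‖ * ‖z‖ * ‖F t‖ ≤ K * ‖F t‖ := by
        gcongr
        nlinarith
      nlinarith

lemma airy_poly (g : ℂ → ℂ) (hg : Differentiable ℂ g) (A : ℝ) (hA : 0 < A)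
    (hre : ∀ z, (g z).re ≤ A * (1 + ‖z‖) ^ 2) :
    ∃ G : ℂ[X], ∀ z, g z = G.eval z := by
  have hbound : ∀ R : ℝ, 1 ≤ R → ∀ z ∈ sphere (0 : ℂ) R,
      ‖g z‖ ≤ (18 * A + 3 * ‖g 0‖) * R ^ 2 := by
    intro R hR z hz
    have hz' : ‖z‖ = R := by simpa using hz
    have hR0 : 0 < R := by linarith
    have := Complex.borelCaratheodory (f := g) (M := 9 * A * R ^ 2) (R := 2 * R) (z := z)
      (by positivity) hg.differentiableOn ?_ (by positivity) (by simp [hz']; linarith)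
    · have e : 2 * (9 * A * R ^ 2) * R / (2 * R - R) + ‖g 0‖ * (2 * R + R) / (2 * R - R)
          = 18 * A * R ^ 2 + 3 * ‖g 0‖ := by
        rw [show 2 * R - R = R by ring]
        field_simp
        ring
      rw [hz', e] at this
      have h1 : 1 ≤ R ^ 2 := one_le_pow₀ hR
      nlinarith [norm_nonneg (g 0)]
    · intro w hw
      have hw' : ‖w‖ < 2 * R := by simpa using hw
      have := hre w
      have h2 : (1 + ‖w‖) ^ 2 ≤ (3 * R) ^ 2 := by gcongr; linarith
      simp only [Set.mem_ofPred_eq]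
      nlinarith
  set B := 18 * A + 3 * ‖g 0‖ with hB
  have hB0 : 0 ≤ B := by positivity
  have hit : ∀ n, 3 ≤ n → iteratedDeriv n g 0 = 0 := by
    intro n hn
    rw [← norm_le_zero_iff]
    have hle : ∀ R : ℝ, 1 ≤ R → ‖iteratedDeriv n g 0‖ ≤ (n.factorial * B) / R := by
      intro R hR
      have hR0 : 0 < R := by linarith
      refine (Complex.norm_iteratedDeriv_le_of_forall_mem_sphere_norm_le n hR0
        hg.diffContOnCl (hbound R hR)).trans ?_
      rw [div_le_div_iff₀ (by positivity) hR0]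
      have : R ^ 3 ≤ R ^ n := pow_le_pow_right₀ hR hn
      calc _ = n.factorial * B * R ^ 3 := by ring
        _ ≤ _ := by gcongr
    have hlim : Filter.Tendsto (fun R : ℝ => (n.factorial * B) / R) Filter.atTop (nhds 0) :=
      Filter.Tendsto.div_atTop tendsto_const_nhds Filter.tendsto_id
    refine ge_of_tendsto hlim ?_
    filter_upwards [Filter.eventually_ge_atTop 1] with R hR using hle R hR
  refine ⟨∑ n ∈ Finset.range 3, C ((n.factorial : ℂ)⁻¹ * iteratedDeriv n g 0) * X ^ n, fun z => ?_⟩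
  have := Complex.hasSum_taylorSeries_of_entire hg 0 z
  have h2 := this.unique (hasSum_sum_of_ne_finset_zero (s := Finset.range 3) ?_)
  · rw [h2, eval_finsetSum]
    apply Finset.sum_congr rfl
    intro n _
    simp
    ring
  · intro n hn
    rw [hit n (by simpa using hn)]
    simp

lemma airy_degree (P D : ℂ[X]) (hP : P ≠ 0) :
    0 < (P * (derivative D + D ^ 2 - X) +
      (2 * derivative P * D + derivative (derivative P))).degree := by
  set E := derivative D + D ^ 2 - X with hE
  -- degree of E is positive and at least that of D
  have hED : 0 < E.degree ∧ D.degree ≤ E.degree := by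
    by_cases hd : D.natDegree = 0
    · obtain ⟨a, rfl⟩ : ∃ a, D = C a := ⟨_, eq_C_of_natDegree_eq_zero hd⟩
      have : E = -(X - C (a ^ 2)) := by rw [hE]; simp
      rw [this, degree_neg, degree_X_sub_C]
      exact ⟨by norm_num, degree_C_le.trans (by norm_num)⟩
    · have hd1 : 1 ≤ D.natDegree := Nat.one_le_iff_ne_zero.mpr hd
      have hD0 : D ≠ 0 := by rintro rfl; simp at hd
      have h2 : (D ^ 2).degree = ((2 * D.natDegree : ℕ) : WithBot ℕ) := by
        rw [degree_eq_natDegree (pow_ne_zero _ hD0), natDegree_pow]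
      have h1 : (derivative D - X).degree < (D ^ 2).degree := by
        rw [h2]
        refine (degree_sub_le _ _).trans_lt (max_lt ?_ ?_)
        · refine (degree_derivative_lt hD0).trans_le ?_
          rw [degree_eq_natDegree hD0]
          exact_mod_cast (by omega)
        · rw [degree_X]
          exact_mod_cast (by omega)
      have h3 : E.degree = ((2 * D.natDegree : ℕ) : WithBot ℕ) := by
        rw [show E = D ^ 2 + (derivative D - X) by rw [hE]; ring,
          degree_add_eq_left_of_degree_lt h1, h2]
      rw [h3, degree_eq_natDegree hD0]
      constructor
      · exact_mod_cast (by omega)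
      · exact_mod_cast (by omega)
  obtain ⟨hE0, hDE⟩ := hED
  have hEne : E ≠ 0 := by rintro h; simp [h] at hE0
  have hPd : 0 ≤ P.degree := zero_le_degree_iff.mpr hP
  have hlt : (derivative P).degree < P.degree := degree_derivative_lt hP
  have hPE : (P * E).degree = ((P.natDegree + E.natDegree : ℕ) : WithBot ℕ) := by
    rw [degree_eq_natDegree (mul_ne_zero hP hEne), natDegree_mul hP hEne]
  have hEn : 0 < E.natDegree := natDegree_pos_iff_degree_pos.mpr hE0
  have hDn : D.natDegree ≤ E.natDegree := natDegree_le_natDegree hDE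
  rw [degree_add_eq_left_of_degree_lt, hPE]
  · exact_mod_cast (by omega)
  · rw [hPE]
    by_cases hp : derivative P = 0
    · rw [hp]; simp
    · have hlt' : (derivative P).natDegree < P.natDegree := natDegree_lt_natDegree hp hlt
      refine degree_le_natDegree.trans_lt ?_
      have e1 : (2 * derivative P * D).natDegree ≤ (derivative P).natDegree + D.natDegree := by
        refine natDegree_mul_le.trans ?_
        gcongr
        have : (2 : ℂ[X]) = C 2 := (map_ofNat C 2).symm
        rw [this]
        exact natDegree_C_mul_le _ _
      have e2 := natDegree_derivative_le (derivative P)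
      have e3 := natDegree_add_le (2 * derivative P * D) (derivative (derivative P))
      have e4 : (2 * derivative P * D + derivative (derivative P)).natDegree
          < P.natDegree + E.natDegree := by
        refine e3.trans_lt (max_lt ?_ ?_) <;> omega
      exact_mod_cast e4

lemma airy_no_poly_exp (c : ℂ) (y : ℂ → ℂ)
    (hode : ∀ z : ℂ, deriv (deriv y) z = z * y z + c)
    (P G : ℂ[X]) (hP : P ≠ 0) (hyP : ∀ z, y z = P.eval z * Complex.exp (G.eval z)) : False := by
  have hder : ∀ (P : ℂ[X]) (z : ℂ), HasDerivAt (fun z => P.eval z * Complex.exp (G.eval z))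
      ((derivative P + P * derivative G).eval z * Complex.exp (G.eval z)) z := by
    intro P z
    refine ((P.hasDerivAt z).mul ((G.hasDerivAt z).cexp)).congr_deriv ?_
    simp
    ring
  have hy1 : y = fun z => P.eval z * Complex.exp (G.eval z) := funext hyP
  have hd1 : deriv y = fun z =>
      (derivative P + P * derivative G).eval z * Complex.exp (G.eval z) := by
    rw [hy1]
    exact funext fun z => (hder P z).deriv
  set D := derivative G with hD
  set Q := P * (derivative D + D ^ 2 - X) +
      (2 * derivative P * D + derivative (derivative P)) with hQ
  have hQc : ∀ z, Q.eval z * Complex.exp (G.eval z) = c := by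
    intro z
    have h1 := hode z
    rw [hd1, (hder _ z).deriv, hyP z] at h1
    have h2 : c = _ := (sub_eq_iff_eq_add'.mpr h1).symm
    rw [h2, hQ]
    simp
    ring
  have hdeg : 0 < Q.degree := airy_degree P D hP
  obtain ⟨w, hw⟩ := Complex.exists_root hdeg
  have hc : c = 0 := by rw [← hQc w, hw.eq_zero, zero_mul]
  have hQ0 : Q = 0 := by
    apply Polynomial.funext
    intro z
    have := hQc z
    rw [hc] at this
    simpa [Complex.exp_ne_zero] using this
  rw [hQ0] at hdeg
  simp at hdeg

/-- Every entire solution of the nonhomogeneous Airy equation `y'' = z y + c`, other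
than the identically vanishing one, has infinitely many zeros. -/
theorem nonhomogeneous_airy_infinitely_many_zeros (c : ℂ) (y : ℂ → ℂ)
    (hy : Differentiable ℂ y)
    (hode : ∀ z : ℂ, deriv (deriv y) z = z * y z + c)
    (hne : y ≠ 0) :
    {z : ℂ | y z = 0}.Infinite := by

  intro hfin
  obtain ⟨P, h, R, hP, hh, hS, hfac, hR⟩ := airy_factor y hy hne hfin.toFinset
  have h0 : ∀ z, h z ≠ 0 := by
    intro z hz
    exact hS z (by simp [hfac z, hz]) hz
  obtain ⟨g, hg, hgh⟩ := airy_log h hh h0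
  obtain ⟨A, hA, hgrow⟩ := airy_growth c y hy hode
  obtain ⟨B, hB⟩ := (isCompact_closedBall (0 : ℂ) R).exists_bound_of_continuousOn
    hh.continuous.continuousOn
  set M : ℝ := A + |B| + 1 with hM
  have hM1 : 1 ≤ M := by have := abs_nonneg B; linarith
  have hhb : ∀ z, ‖h z‖ ≤ M * Real.exp ((1 + ‖z‖) ^ 2) := by
    intro z
    have he : 1 ≤ Real.exp ((1 + ‖z‖) ^ 2) := Real.one_le_exp (by positivity)
    have hBa := abs_nonneg B
    rcases le_total R ‖z‖ with hz | hz
    · have h1 := hgrow z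
      rw [hfac z, norm_mul] at h1
      have h2 := hR z hz
      have h3 : ‖h z‖ ≤ ‖P.eval z‖ * ‖h z‖ := le_mul_of_one_le_left (norm_nonneg _) h2
      refine (h3.trans h1).trans ?_
      gcongr
      linarith
    · have h1 := hB z (by simpa using hz)
      have h2 := le_abs_self B
      have : M * 1 ≤ M * Real.exp ((1 + ‖z‖) ^ 2) := by gcongr
      linarith
  have hlog : 0 ≤ Real.log M := Real.log_nonneg hM1
  obtain ⟨G, hG⟩ := airy_poly g hg (Real.log M + 1) (by linarith) (by
    intro z
    have h1 := hhb z
    rw [hgh z, Complex.norm_exp, ← Real.exp_log (show 0 < M by linarith), ← Real.exp_add,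
      Real.exp_le_exp] at h1
    have h2 : 1 ≤ (1 + ‖z‖) ^ 2 := one_le_pow₀ (by linarith [norm_nonneg z])
    nlinarith)
  exact airy_no_poly_exp c y hode P G hP (fun z => by rw [hfac z, hgh z, hG z])
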